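/- For every integer r ≥ 2, the packing chromatic number of the generalised H-graph H^2(r) equals 7 if r ∈ {2,4,7,8,11}, and equals 6 otherwise. -/

import Mathlib

/-- A packing `k`-colouring of a simple graph `G`: every vertex gets a colour in
`{1, …, k}` and any two distinct vertices sharing a colour `i` are at distance
greater than `i` in `G` (i.e. every walk joining them has length greater than `i`). -/
def IsPackingColoring {V : Type*} (G : SimpleGraph V) (k : ℕ) (π : V → ℕ) : Prop :=
  (∀ v, 1 ≤ π v ∧ π v ≤ k) ∧
    ∀ u v : V, u ≠ v → π u = π v → ∀ p : G.Walk u v, π u < p.length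

/-- The packing chromatic number of `G`: the least `k` admitting a packing `k`-colouring. -/
noncomputable def packingChromaticNumber {V : Type*} (G : SimpleGraph V) : ℕ :=
  sInf {k | ∃ π : V → ℕ, IsPackingColoring G k π}

/-- The generalised H-graph `H^ℓ(r)` with `ℓ` levels: vertices `uⁱⱼ = (i, j)` for
`i : Fin (ℓ+2)` and `j : ZMod (2*r)`; the outer cycles are on levels `0` and `ℓ+1`,
level `i` (`1 ≤ i ≤ ℓ`) carries the matching edges `uⁱ₂ⱼuⁱ₂ⱼ₊₁` (`0 ≤ j ≤ r-1`),
and `uⁱⱼ` is joined to `uⁱ⁺¹ⱼ` for `0 ≤ i ≤ ℓ`. -/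
def genHgraph (ℓ r : ℕ) : SimpleGraph (Fin (ℓ + 2) × ZMod (2 * r)) :=
  SimpleGraph.fromRel (fun x y =>
    (∃ j : ZMod (2 * r), x = ((0 : Fin (ℓ + 2)), j) ∧ y = ((0 : Fin (ℓ + 2)), j + 1)) ∨
    (∃ j : ZMod (2 * r), x = (Fin.last (ℓ + 1), j) ∧ y = (Fin.last (ℓ + 1), j + 1)) ∨
    (∃ i : Fin (ℓ + 2), ∃ j : ℕ, 1 ≤ (i : ℕ) ∧ (i : ℕ) ≤ ℓ ∧ j < r ∧
      x = (i, ((2 * j : ℕ) : ZMod (2 * r))) ∧ y = (i, ((2 * j + 1 : ℕ) : ZMod (2 * r)))) ∨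
    (∃ i : Fin (ℓ + 2), ∃ j : ZMod (2 * r), (i : ℕ) ≤ ℓ ∧ x = (i, j) ∧ y = (i + 1, j)))

namespace GenHgraph

/-- Vertex `v` of a strip of columns, counted column by column, in `genHgraph 2 r`: column `0` of
the strip sits at column `s`, and the columns run in the direction `ε`. -/
def place (r : ℕ) (s ε : ℤ) (v : ℕ) : Fin (2 + 2) × ZMod (2 * r) :=
  (Fin.ofNat 4 v, ((s + ε * ((v / 4 : ℕ) : ℤ) : ℤ) : ZMod (2 * r)))

lemma adj_iff {r : ℕ} (hr : 2 ≤ r) (i : Fin (2 + 2)) (z : ℤ) (x : Fin (2 + 2) × ZMod (2 * r)) :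
    (genHgraph 2 r).Adj (i, (z : ZMod (2 * r))) x ↔
      (i ≠ 3 ∧ x = (i + 1, (z : ZMod (2 * r)))) ∨ (i ≠ 0 ∧ x = (i - 1, (z : ZMod (2 * r)))) ∨
      ((i = 0 ∨ i = 3 ∨ Even z) ∧ x = (i, ((z + 1 : ℤ) : ZMod (2 * r)))) ∨
      ((i = 0 ∨ i = 3 ∨ Odd z) ∧ x = (i, ((z - 1 : ℤ) : ZMod (2 * r)))) := by
  have one_ne : (1 : ZMod (2 * r)) ≠ 0 := by
    have : Fact (1 < 2 * r) := ⟨by omega⟩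
    exact one_ne_zero
  have par {a : ℤ} {n : ℕ} (h : (a : ZMod (2 * r)) = ((n : ℕ) : ZMod (2 * r))) :
      Even a ↔ Even n := by
    have h' : (a : ZMod (2 * r)) = ((n : ℤ) : ZMod (2 * r)) := by simpa using h
    rw [ZMod.intCast_eq_intCast_iff_dvd_sub] at h'
    obtain ⟨c, hc⟩ := h'
    push_cast at hc
    have : (n : ℤ) = a + 2 * (r * c) := by linarith
    rw [← Int.even_coe_nat, this, Int.even_add]
    simp
  have rep (a : ℤ) (ha : Even a) : ∃ j < r, (a : ZMod (2 * r)) = ((2 * j : ℕ) : ZMod (2 * r)) := by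
    obtain ⟨b, rfl⟩ := ha
    have hr0 : (0 : ℤ) < r := by omega
    refine ⟨(b % r).toNat, ?_, ?_⟩
    · have := Int.emod_lt_of_pos b hr0
      have := Int.emod_nonneg b hr0.ne'
      omega
    · have h2 : ((2 * (b % r).toNat : ℕ) : ℤ) = 2 * (b % r) := by
        rw [Nat.cast_mul, Int.toNat_of_nonneg (Int.emod_nonneg b hr0.ne')]
        rfl
      have : ((2 * (b % r).toNat : ℕ) : ZMod (2 * r)) = ((2 * (b % r) : ℤ) : ZMod (2 * r)) := by
        rw [← h2]; exact (Int.cast_natCast _).symm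
      rw [this, ZMod.intCast_eq_intCast_iff_dvd_sub]
      refine ⟨-(b / r), ?_⟩
      have := Int.emod_add_mul_ediv b r
      push_cast
      linarith
  simp only [genHgraph, SimpleGraph.fromRel_adj]
  constructor
  · rintro ⟨-, (⟨j, h, rfl⟩ | ⟨j, h, rfl⟩ | ⟨k, j, h1, h2, h3, h, rfl⟩ | ⟨k, j, h1, h, rfl⟩) |
      (⟨j, rfl, h⟩ | ⟨j, rfl, h⟩ | ⟨k, j, h1, h2, h3, rfl, h⟩ | ⟨k, j, h1, rfl, h⟩)⟩ <;>
    simp only [Prod.mk.injEq] at h <;> obtain ⟨rfl, h'⟩ := h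
    · simp [h']
    · right; right; left
      exact ⟨Or.inr (Or.inl rfl), by simp [h']⟩
    · right; right; left
      exact ⟨Or.inr (Or.inr ((par h').2 (even_two_mul j))), by simp [h']⟩
    · left
      refine ⟨?_, by rw [h']⟩
      rintro rfl
      simp at h1
    · right; right; right
      exact ⟨Or.inl rfl, by simp [h']⟩
    · right; right; right
      exact ⟨Or.inr (Or.inl rfl), by simp [h']⟩
    · right; right; right
      refine ⟨Or.inr (Or.inr ?_), by simp [h']⟩
      rw [← Int.not_even_iff_odd, par h']
      simp
    · right; left
      refine ⟨?_, by simp [h']⟩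
      intro h0
      have : k = 3 := by
        rw [← sub_eq_zero] at h0 ⊢
        revert h0; revert k; decide
      subst this
      simp at h1
  · rintro (⟨hi, rfl⟩ | ⟨hi, rfl⟩ | ⟨hi, rfl⟩ | ⟨hi, rfl⟩)
    · refine ⟨by simp, Or.inl (Or.inr (Or.inr (Or.inr ⟨i, z, ?_, rfl, rfl⟩)))⟩
      revert i; decide
    · refine ⟨by simp [sub_eq_self, eq_comm (a := i)],
        Or.inr (Or.inr (Or.inr (Or.inr ⟨i - 1, z, ?_, rfl, by simp⟩)))⟩
      revert i; decide
    · refine ⟨by simp [one_ne], Or.inl ?_⟩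
      obtain rfl | rfl | hz := hi
      · exact Or.inl ⟨z, rfl, by simp⟩
      · exact Or.inr (Or.inl ⟨z, rfl, by simp⟩)
      · by_cases h0 : i = 0
        · exact Or.inl ⟨z, by rw [h0], by simp [h0]⟩
        by_cases h3 : i = 3
        · exact Or.inr (Or.inl ⟨z, by rw [h3]; rfl, by simp [h3]⟩)
        obtain ⟨j, hj, hz'⟩ := rep z hz
        refine Or.inr (Or.inr (Or.inl ⟨i, j, ?_, ?_, hj, by rw [hz'], by simp [hz']⟩)) <;>
        revert h0 h3 <;> revert i <;> decide
    · refine ⟨by simp [one_ne, eq_comm (a := (z : ZMod (2 * r)))], Or.inr ?_⟩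
      obtain rfl | rfl | hz := hi
      · exact Or.inl ⟨z - 1, by simp, by simp⟩
      · exact Or.inr (Or.inl ⟨z - 1, by simp, by simp⟩)
      · by_cases h0 : i = 0
        · exact Or.inl ⟨z - 1, by simp [h0], by simp [h0]⟩
        by_cases h3 : i = 3
        · exact Or.inr (Or.inl ⟨z - 1, by simp [h3], by simp [h3]⟩)
        obtain ⟨j, hj, hz'⟩ := rep (z - 1) (hz.sub_odd odd_one)
        have hz2 : (z : ZMod (2 * r)) = ((2 * j : ℕ) : ZMod (2 * r)) + 1 := by
          rw [← hz']; simp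
        refine Or.inr (Or.inr (Or.inl ⟨i, j, ?_, ?_, hj, by rw [hz'], by rw [hz2]; simp⟩)) <;>
        revert h0 h3 <;> revert i <;> decide

/-- The neighbours of vertex `v` of a strip of `2 * m` columns, counted column by column; the strip
is closed up to `genHgraph 2 m` if `cyc` is set. -/
def nbr (m : ℕ) (cyc : Bool) (v : ℕ) : List ℕ :=
  (if v % 4 ≠ 3 then [v + 1] else []) ++ ((if v % 4 ≠ 0 then [v - 1] else []) ++
  ((if v % 4 = 0 ∨ v % 4 = 3 ∨ v / 4 % 2 = 0 then
    if v + 4 < 8 * m then [v + 4] else if cyc then [v + 4 - 8 * m] else [] else []) ++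
  (if v % 4 = 0 ∨ v % 4 = 3 ∨ v / 4 % 2 = 1 then
    if 4 ≤ v then [v - 4] else if cyc then [v + 8 * m - 4] else [] else [])))

/-- Vertices whose neighbours in the infinite strip all lie in the finite one. -/
def isInner (m : ℕ) (cyc : Bool) (v : ℕ) : Bool :=
  cyc || (4 ≤ v && v + 4 < 8 * m) || v % 4 == 1 || v % 4 == 2

lemma mem_nbr_iff {m : ℕ} {cyc : Bool} {u v : ℕ} (hv : v < 8 * m) :
    u ∈ nbr m cyc v ↔ (v % 4 ≠ 3 ∧ u = v + 1) ∨ (v % 4 ≠ 0 ∧ u + 1 = v) ∨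
      ((v % 4 = 0 ∨ v % 4 = 3 ∨ v / 4 % 2 = 0) ∧
        (u < 8 * m ∧ u = v + 4 ∨ cyc = true ∧ u < 4 ∧ u + 8 * m = v + 4)) ∨
      ((v % 4 = 0 ∨ v % 4 = 3 ∨ v / 4 % 2 = 1) ∧
        (u + 4 = v ∨ cyc = true ∧ v < 4 ∧ u + 4 = v + 8 * m)) := by
  simp only [nbr, List.mem_append, List.mem_ite_nil_right]
  refine or_congr (and_congr_right fun h => ?_) (or_congr (and_congr_right fun h => ?_)
    (or_congr (and_congr_right fun h => ?_) (and_congr_right fun h => ?_)))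
  · simp
  · simp only [List.mem_singleton]
    omega
  · cases cyc <;> simp only [Bool.false_eq_true, if_false, if_true, false_and, true_and] <;>
    split_ifs <;> simp only [List.mem_singleton, List.not_mem_nil, or_false, false_iff] <;> omega
  · cases cyc <;> simp only [Bool.false_eq_true, if_false, if_true, false_and, true_and] <;>
    split_ifs <;> simp only [List.mem_singleton, List.not_mem_nil, or_false, false_iff] <;> omega

lemma nbr_lt {m : ℕ} {cyc : Bool} {u v : ℕ} (hv : v < 8 * m) (hu : u ∈ nbr m cyc v) :
    u < 8 * m := by
  rw [mem_nbr_iff hv] at hu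
  cases cyc <;> simp only [Bool.false_eq_true, false_and, true_and, or_false] at hu <;> omega

lemma mem_nbr_symm {m : ℕ} {cyc : Bool} {u v : ℕ} (hv : v < 8 * m) (hu : u ∈ nbr m cyc v) :
    v ∈ nbr m cyc u := by
  have hu' := nbr_lt hv hu
  rw [mem_nbr_iff hv] at hu
  rw [mem_nbr_iff hu']
  rcases hu with ⟨h1, rfl⟩ | ⟨h1, rfl⟩ | ⟨h1, ⟨-, rfl⟩ | ⟨hc, h2, h3⟩⟩ | ⟨h1, rfl | ⟨hc, h2, h3⟩⟩
  · exact Or.inr (Or.inl ⟨by omega, rfl⟩)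
  · exact Or.inl ⟨by omega, rfl⟩
  · exact Or.inr (Or.inr (Or.inr ⟨by omega, Or.inl rfl⟩))
  · exact Or.inr (Or.inr (Or.inr ⟨by omega, Or.inr ⟨hc, h2, h3.symm⟩⟩))
  · exact Or.inr (Or.inr (Or.inl ⟨by omega, Or.inl ⟨hv, rfl⟩⟩))
  · exact Or.inr (Or.inr (Or.inl ⟨by omega, Or.inr ⟨hc, h2, h3.symm⟩⟩))

/-- The strips of columns that lie in `genHgraph 2 r` in the right position. -/
structure IsPlacement (r m : ℕ) (cyc : Bool) (s ε : ℤ) : Prop where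
  two_le : 2 ≤ r
  dir : ε = 1 ∧ Even s ∨ ε = -1 ∧ Odd s
  cyclic : cyc → m = r

variable {r m : ℕ} {cyc : Bool} {s ε : ℤ}

lemma place_add_one {v : ℕ} (hv : v % 4 ≠ 3) :
    place r s ε (v + 1) = ((place r s ε v).1 + 1, (place r s ε v).2) := by
  have : (v + 1) / 4 = v / 4 := by omega
  simp only [place, this, Prod.mk.injEq, and_true]
  ext
  simp [Fin.val_add, Fin.ofNat]

lemma place_sub_one {v : ℕ} (hv : v % 4 ≠ 0) :
    place r s ε (v - 1) = ((place r s ε v).1 - 1, (place r s ε v).2) := by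
  obtain ⟨w, rfl⟩ : ∃ w, v = w + 1 := ⟨v - 1, by omega⟩
  rw [place_add_one (by omega)]
  simp

lemma place_add_four (v : ℕ) :
    place r s ε (v + 4) = ((place r s ε v).1, (place r s ε v).2 + ε) := by
  have : (v + 4) / 4 = v / 4 + 1 := by omega
  simp only [place, this, Prod.mk.injEq]
  constructor
  · ext; simp [Fin.ofNat]
  · push_cast; ring

lemma place_sub_four {v : ℕ} (hv : 4 ≤ v) :
    place r s ε (v - 4) = ((place r s ε v).1, (place r s ε v).2 - ε) := by
  obtain ⟨w, rfl⟩ : ∃ w, v = w + 4 := ⟨v - 4, by omega⟩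
  rw [place_add_four]
  simp

lemma place_add_period (v : ℕ) : place r s ε (v + 8 * r) = place r s ε v := by
  have : (v + 8 * r) / 4 = v / 4 + 2 * r := by omega
  simp only [place, this, Prod.mk.injEq]
  constructor
  · ext; simp [Fin.ofNat]; omega
  · have h := ZMod.natCast_self (2 * r)
    push_cast at h ⊢
    rw [mul_add, h]; ring

lemma adj_place_iff (h : IsPlacement r m cyc s ε) {v : ℕ} (x : Fin (2 + 2) × ZMod (2 * r)) :
    (genHgraph 2 r).Adj (place r s ε v) x ↔
      (v % 4 ≠ 3 ∧ x = ((place r s ε v).1 + 1, (place r s ε v).2)) ∨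
      (v % 4 ≠ 0 ∧ x = ((place r s ε v).1 - 1, (place r s ε v).2)) ∨
      ((v % 4 = 0 ∨ v % 4 = 3 ∨ v / 4 % 2 = 0) ∧
        x = ((place r s ε v).1, (place r s ε v).2 + ε)) ∨
      ((v % 4 = 0 ∨ v % 4 = 3 ∨ v / 4 % 2 = 1) ∧
        x = ((place r s ε v).1, (place r s ε v).2 - ε)) := by
  have h0 : Fin.ofNat 4 v = (0 : Fin 4) ↔ v % 4 = 0 := by
    simp [Fin.ext_iff, Fin.ofNat]
  have h3 : Fin.ofNat 4 v = (3 : Fin 4) ↔ v % 4 = 3 := by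
    simp [Fin.ext_iff, Fin.ofNat]
  rw [place, adj_iff h.two_le]
  simp only [ne_eq, h0, h3]
  obtain ⟨rfl, hs⟩ | ⟨rfl, hs⟩ := h.dir
  · have he : Even (s + 1 * ((v / 4 : ℕ) : ℤ)) ↔ v / 4 % 2 = 0 := by
      rw [one_mul, Int.even_add, Int.even_coe_nat, Nat.even_iff]; simp [hs]
    have ho : Odd (s + 1 * ((v / 4 : ℕ) : ℤ)) ↔ v / 4 % 2 = 1 := by
      rw [← Int.not_even_iff_odd, he]; omega
    simp only [he, ho, Int.cast_add, Int.cast_sub, Int.cast_one]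
  · have he : Even (s + -1 * ((v / 4 : ℕ) : ℤ)) ↔ v / 4 % 2 = 1 := by
      rw [Int.even_add, neg_one_mul, even_neg, Int.even_coe_nat, ← Int.not_odd_iff_even,
        Nat.even_iff]; simp [hs]
    have ho : Odd (s + -1 * ((v / 4 : ℕ) : ℤ)) ↔ v / 4 % 2 = 0 := by
      rw [← Int.not_even_iff_odd, he]; omega
    simp only [he, ho, Int.cast_add, Int.cast_sub, Int.cast_one, Int.cast_neg, ← sub_eq_add_neg,
      sub_neg_eq_add]
    rw [or_comm (a := _ ∧ x = (_, _ + 1))]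

lemma adj_place_of_mem_nbr (h : IsPlacement r m cyc s ε) {u v : ℕ} (hv : v < 8 * m)
    (hu : u ∈ nbr m cyc v) : (genHgraph 2 r).Adj (place r s ε v) (place r s ε u) := by
  rw [adj_place_iff h]
  rw [mem_nbr_iff hv] at hu
  rcases hu with ⟨h1, rfl⟩ | ⟨h1, rfl⟩ | ⟨h1, ⟨-, rfl⟩ | ⟨hc, -, hu⟩⟩ | ⟨h1, rfl | ⟨hc, -, hu⟩⟩
  · exact Or.inl ⟨h1, place_add_one h1⟩
  · exact Or.inr (Or.inl ⟨h1, place_sub_one h1⟩)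
  · exact Or.inr (Or.inr (Or.inl ⟨h1, place_add_four v⟩))
  · refine Or.inr (Or.inr (Or.inl ⟨h1, ?_⟩))
    rw [← place_add_four, ← hu, h.cyclic hc, place_add_period]
  · exact Or.inr (Or.inr (Or.inr ⟨h1, place_sub_four (Nat.le_add_left 4 u)⟩))
  · refine Or.inr (Or.inr (Or.inr ⟨h1, ?_⟩))
    rw [← place_add_period v, ← h.cyclic hc, ← hu, ← place_sub_four (Nat.le_add_left 4 u),
      Nat.add_sub_cancel]

lemma exists_mem_nbr_of_adj_place (h : IsPlacement r m cyc s ε) {v : ℕ} (hv : v < 8 * m)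
    (hi : isInner m cyc v) {x : Fin (2 + 2) × ZMod (2 * r)}
    (hx : (genHgraph 2 r).Adj (place r s ε v) x) : ∃ u ∈ nbr m cyc v, place r s ε u = x := by
  simp only [mem_nbr_iff hv]
  simp only [isInner, Bool.or_eq_true, Bool.and_eq_true, decide_eq_true_eq, beq_iff_eq] at hi
  rw [adj_place_iff h] at hx
  rcases hx with ⟨h1, rfl⟩ | ⟨h1, rfl⟩ | ⟨h1, rfl⟩ | ⟨h1, rfl⟩
  · exact ⟨v + 1, by omega, place_add_one h1⟩
  · exact ⟨v - 1, by omega, place_sub_one h1⟩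
  · by_cases h2 : v + 4 < 8 * m
    · exact ⟨v + 4, by omega, place_add_four v⟩
    · have hc : cyc = true := by
        by_contra hc
        simp only [hc, false_or] at hi
        omega
      refine ⟨v + 4 - 8 * m, by simp only [hc, true_and]; omega, ?_⟩
      rw [← place_add_four, ← place_add_period (v + 4 - 8 * m), ← h.cyclic hc,
        Nat.sub_add_cancel (by omega)]
  · by_cases h2 : 4 ≤ v
    · exact ⟨v - 4, by omega, place_sub_four h2⟩
    · have hc : cyc = true := by
        by_contra hc
        simp only [hc, false_or] at hi
        omega
      refine ⟨v + 8 * m - 4, by simp only [hc, true_and]; omega, ?_⟩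
      rw [place_sub_four (by omega), h.cyclic hc, place_add_period]

/-- `w` can be reached from `v` in at most `n` steps. -/
def InBall (m : ℕ) (cyc : Bool) : ℕ → ℕ → ℕ → Prop
  | 0, v, w => w = v
  | n + 1, v, w => InBall m cyc n v w ∨ ∃ u ∈ nbr m cyc v, InBall m cyc n u w

lemma InBall.lt {n v w : ℕ} (hv : v < 8 * m) (h : InBall m cyc n v w) : w < 8 * m := by
  induction n generalizing v with
  | zero => exact h ▸ hv
  | succ n ih =>
    obtain h | ⟨u, hu, h⟩ := h
    · exact ih hv h
    · exact ih (nbr_lt hv hu) h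

lemma InBall.exists_walk (hP : IsPlacement r m cyc s ε) {n v w : ℕ} (hv : v < 8 * m)
    (h : InBall m cyc n v w) :
    ∃ p : (genHgraph 2 r).Walk (place r s ε v) (place r s ε w), p.length ≤ n := by
  induction n generalizing v with
  | zero =>
    obtain rfl : w = v := h
    exact ⟨.nil, le_rfl⟩
  | succ n ih =>
    obtain h | ⟨u, hu, h⟩ := h
    · obtain ⟨p, hp⟩ := ih hv h
      exact ⟨p, by omega⟩
    · obtain ⟨p, hp⟩ := ih (nbr_lt hv hu) h
      exact ⟨.cons (adj_place_of_mem_nbr hP hv hu) p, by simpa using hp⟩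

/-- Short walks starting far enough from the ends of the strip stay in the strip. -/
lemma exists_inBall_of_walk (hP : IsPlacement r m cyc s ε) {n v : ℕ} (hv : v < 8 * m)
    (hn : cyc = false → 4 * n ≤ v ∧ v + 4 * n < 8 * m) {x y : Fin (2 + 2) × ZMod (2 * r)}
    (p : (genHgraph 2 r).Walk x y) (hx : place r s ε v = x) (hp : p.length ≤ n) :
    ∃ w, place r s ε w = y ∧ InBall m cyc n v w := by
  induction n generalizing v x with
  | zero =>
    obtain rfl := SimpleGraph.Walk.eq_of_length_eq_zero (Nat.le_zero.1 hp)
    exact ⟨v, hx, rfl⟩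
  | succ n ih =>
    cases p with
    | nil =>
      obtain ⟨w, hw, h⟩ := ih hv (fun h => by have := hn h; omega) .nil hx (Nat.zero_le n)
      exact ⟨w, hw, Or.inl h⟩
    | cons hadj q =>
      subst hx
      have hi : isInner m cyc v := by
        cases hc : cyc
        · have := hn hc
          simp only [isInner, Bool.or_eq_true, Bool.and_eq_true, decide_eq_true_eq]
          omega
        · simp [isInner]
      obtain ⟨u, hu, rfl⟩ := exists_mem_nbr_of_adj_place hP hv hi hadj
      have hu' : cyc = false → 4 * n ≤ u ∧ u + 4 * n < 8 * m := by
        rintro rfl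
        have := hn rfl
        rw [mem_nbr_iff hv] at hu
        simp only [Bool.false_eq_true, false_and, or_false] at hu
        omega
      obtain ⟨w, hw, h⟩ := ih (nbr_lt hv hu) hu' q rfl (by simpa using hp)
      exact ⟨w, hw, Or.inr ⟨u, hu, h⟩⟩

/-- From a list of vertex sets, as bit masks, the list of their unions over neighbourhoods. -/
def grow (m : ℕ) (cyc : Bool) (T : List ℕ) : List ℕ :=
  (List.range (8 * m)).map fun v =>
    (nbr m cyc v).foldr (fun u x => T.getD u 0 ||| x) (T.getD v 0)

/-- The balls of radius `n`, as bit masks. -/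
def ballTable (m : ℕ) (cyc : Bool) : ℕ → List ℕ
  | 0 => (List.range (8 * m)).map fun v => 1 <<< v
  | n + 1 => grow m cyc (ballTable m cyc n)

lemma testBit_foldr_lor (l : List ℕ) (f : ℕ → ℕ) (a w : ℕ) :
    (l.foldr (fun u x => f u ||| x) a).testBit w = true ↔
      a.testBit w = true ∨ ∃ u ∈ l, (f u).testBit w = true := by
  induction l with
  | nil => simp
  | cons b l ih => simp [ih, or_left_comm]

lemma testBit_ballTable (n : ℕ) {v : ℕ} (hv : v < 8 * m) (w : ℕ) :
    ((ballTable m cyc n).getD v 0).testBit w = true ↔ InBall m cyc n v w := by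
  induction n generalizing v with
  | zero =>
    simp [ballTable, InBall, List.getD_eq_getElem?_getD, hv, Nat.one_shiftLeft, Nat.testBit_two_pow,
      eq_comm]
  | succ n ih =>
    have h : (ballTable m cyc (n + 1)).getD v 0 = (nbr m cyc v).foldr
        (fun u x => (ballTable m cyc n).getD u 0 ||| x) ((ballTable m cyc n).getD v 0) := by
      simp [ballTable, grow, List.getD_eq_getElem?_getD, hv]
    rw [h, testBit_foldr_lor, ih hv, InBall]
    refine or_congr_right (exists_congr fun u => and_congr_right fun hu => ih (nbr_lt hv hu))

/-- `force n k = k n`, arranged so that the kernel evaluates `n` first. -/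
def force {α : Type} (n : ℕ) (k : ℕ → α) : α :=
  Nat.rec (motive := fun _ => α) (k 0) (fun m _ => k m) (Nat.succ n)

lemma force_eq {α : Type} (n : ℕ) (k : ℕ → α) : force n k = k n := rfl

/-- `forceList l k = k l`, arranged so that the kernel evaluates the entries of `l` first. -/
def forceList {α : Type} (l : List ℕ) : (List ℕ → α) → α :=
  List.rec (motive := fun _ => (List ℕ → α) → α) (fun k => k [])
    (fun a _ ih k => force a fun a' => ih fun l' => k (a' :: l')) l

lemma forceList_eq {α : Type} (l : List ℕ) (k : List ℕ → α) : forceList l k = k l := by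
  induction l generalizing k with
  | nil => rfl
  | cons a l ih => exact ih _

/-- Data used when colouring a vertex: the vertices that must by then have a vertex of colour `1`
next to them, and the vertices to which the colours are then denied. -/
structure Row where
  need : ℕ
  b1 : ℕ
  b2 : ℕ
  b3 : ℕ
  b4 : ℕ
  b5 : ℕ
  b6 : ℕ

/-- `forceRows l k = k l`, arranged so that the kernel evaluates the entries of `l` first. -/
def forceRows {α : Type} (l : List Row) : (List Row → α) → α :=
  List.rec (motive := fun _ => (List Row → α) → α) (fun k => k [])
    (fun a _ ih k => force a.need fun n => force a.b1 fun b1 => force a.b2 fun b2 =>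
      force a.b3 fun b3 => force a.b4 fun b4 => force a.b5 fun b5 => force a.b6 fun b6 =>
      ih fun l' => k (⟨n, b1, b2, b3, b4, b5, b6⟩ :: l')) l

lemma forceRows_eq {α : Type} (l : List Row) (k : List Row → α) : forceRows l k = k l := by
  induction l generalizing k with
  | nil => rfl
  | cons a l ih => exact ih _

/-- `a || b` if `f` and `t` are disjoint, and `b` otherwise; the kernel evaluates `a` first. -/
def tryColor (t f : ℕ) (a b : Bool) : Bool :=
  Nat.rec (motive := fun _ => Bool) (cond a true b) (fun _ _ => b) (Nat.land f t)

lemma tryColor_true (t f : ℕ) (a : Bool) : tryColor t f a true = true := by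
  unfold tryColor
  cases Nat.land f t <;> cases a <;> rfl

lemma tryColor_of_disjoint {t f : ℕ} (h : f &&& t = 0) (b : Bool) :
    tryColor t f true b = true := by
  have h' : Nat.land f t = 0 := h
  rw [tryColor, h']
  rfl

/-- Call `f` on evaluated arguments. -/
def callForced (f : ℕ → ℕ → ℕ → ℕ → ℕ → ℕ → Bool) (x1 x2 x3 x4 x5 x6 : ℕ) : Bool :=
  force x1 fun y1 => force x2 fun y2 => force x3 fun y3 => force x4 fun y4 => force x5 fun y5 =>
    force x6 fun y6 => f y1 y2 y3 y4 y5 y6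

lemma callForced_eq (f : ℕ → ℕ → ℕ → ℕ → ℕ → ℕ → Bool) (x1 x2 x3 x4 x5 x6 : ℕ) :
    callForced f x1 x2 x3 x4 x5 x6 = f x1 x2 x3 x4 x5 x6 := rfl

/-- Backtracking search for a colouring, vertex by vertex, by the colours `1, …, 6`. The bits of
`f1, …, f6` mark the vertices to which the corresponding colour is denied, starting from the
current vertex (from the fourth vertex before it for `f1`). -/
def search (rows : List Row) : ℕ → ℕ → ℕ → ℕ → ℕ → ℕ → Bool :=
  List.rec (motive := fun _ => ℕ → ℕ → ℕ → ℕ → ℕ → ℕ → Bool) (fun _ _ _ _ _ _ => true)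
    (fun row _ ih f1 f2 f3 f4 f5 f6 =>
      tryColor 16 f1 (callForced ih (Nat.lor (Nat.shiftRight f1 1) row.b1) (Nat.shiftRight f2 1)
        (Nat.shiftRight f3 1) (Nat.shiftRight f4 1) (Nat.shiftRight f5 1) (Nat.shiftRight f6 1)) <|
      cond (Nat.beq (Nat.land f1 row.need) row.need)
        (tryColor 1 f2 (callForced ih (Nat.shiftRight f1 1)
          (Nat.lor (Nat.shiftRight f2 1) row.b2) (Nat.shiftRight f3 1) (Nat.shiftRight f4 1)
          (Nat.shiftRight f5 1) (Nat.shiftRight f6 1)) <|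
        tryColor 1 f3 (callForced ih (Nat.shiftRight f1 1) (Nat.shiftRight f2 1)
          (Nat.lor (Nat.shiftRight f3 1) row.b3) (Nat.shiftRight f4 1) (Nat.shiftRight f5 1)
          (Nat.shiftRight f6 1)) <|
        tryColor 1 f4 (callForced ih (Nat.shiftRight f1 1) (Nat.shiftRight f2 1)
          (Nat.shiftRight f3 1) (Nat.lor (Nat.shiftRight f4 1) row.b4) (Nat.shiftRight f5 1)
          (Nat.shiftRight f6 1)) <|
        tryColor 1 f5 (callForced ih (Nat.shiftRight f1 1) (Nat.shiftRight f2 1)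
          (Nat.shiftRight f3 1) (Nat.shiftRight f4 1) (Nat.lor (Nat.shiftRight f5 1) row.b5)
          (Nat.shiftRight f6 1)) <|
        tryColor 1 f6 (callForced ih (Nat.shiftRight f1 1) (Nat.shiftRight f2 1)
          (Nat.shiftRight f3 1) (Nat.shiftRight f4 1) (Nat.shiftRight f5 1)
          (Nat.lor (Nat.shiftRight f6 1) row.b6)) false) false) rows

/-- The inner vertices all of whose neighbours precede `v`, with `v` itself among them. -/
def settled (m : ℕ) (cyc dom : Bool) (v : ℕ) : ℕ :=
  cond dom ((v :: nbr m cyc v).foldr (fun w x =>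
    if isInner m cyc w && decide (w ≤ v) && (nbr m cyc w).all (· ≤ v) then 1 <<< w ||| x else x)
    0) 0

/-- Run the search on a strip. Every inner vertex is required to have colour `1` or a neighbour of
colour `1` if `dom` is set. -/
def run (m : ℕ) (cyc dom : Bool) (f1 f2 f3 f4 f5 f6 : ℕ) : Bool :=
  forceList (grow m cyc (ballTable m cyc 0)) fun T1 => forceList (grow m cyc T1) fun T2 =>
  forceList (grow m cyc T2) fun T3 => forceList (grow m cyc T3) fun T4 =>
  forceList (grow m cyc T4) fun T5 => forceList (grow m cyc T5) fun T6 =>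
  forceRows ((List.range (8 * m)).map fun v =>
    ⟨settled m cyc dom v <<< 4 >>> v, T1.getD v 0 <<< 3 >>> v, T2.getD v 0 >>> (v + 1),
      T3.getD v 0 >>> (v + 1), T4.getD v 0 >>> (v + 1), T5.getD v 0 >>> (v + 1),
      T6.getD v 0 >>> (v + 1)⟩) fun rows =>
  callForced (search rows) f1 f2 f3 f4 f5 f6

lemma search_cons (row : Row) (rows : List Row) (f1 f2 f3 f4 f5 f6 : ℕ) :
    search (row :: rows) f1 f2 f3 f4 f5 f6 =
      (tryColor 16 f1 (search rows (f1 >>> 1 ||| row.b1) (f2 >>> 1) (f3 >>> 1) (f4 >>> 1)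
        (f5 >>> 1) (f6 >>> 1)) <|
      cond ((f1 &&& row.need).beq row.need)
        (tryColor 1 f2 (search rows (f1 >>> 1) (f2 >>> 1 ||| row.b2) (f3 >>> 1) (f4 >>> 1)
          (f5 >>> 1) (f6 >>> 1)) <|
        tryColor 1 f3 (search rows (f1 >>> 1) (f2 >>> 1) (f3 >>> 1 ||| row.b3) (f4 >>> 1)
          (f5 >>> 1) (f6 >>> 1)) <|
        tryColor 1 f4 (search rows (f1 >>> 1) (f2 >>> 1) (f3 >>> 1) (f4 >>> 1 ||| row.b4)
          (f5 >>> 1) (f6 >>> 1)) <|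
        tryColor 1 f5 (search rows (f1 >>> 1) (f2 >>> 1) (f3 >>> 1) (f4 >>> 1)
          (f5 >>> 1 ||| row.b5) (f6 >>> 1)) <|
        tryColor 1 f6 (search rows (f1 >>> 1) (f2 >>> 1) (f3 >>> 1) (f4 >>> 1)
          (f5 >>> 1) (f6 >>> 1 ||| row.b6)) false) false) := rfl

/-- Packing colourings of a strip by the colours `1, …, 6`. -/
structure IsStripColoring (m : ℕ) (cyc dom : Bool) (κ : ℕ → ℕ) : Prop where
  pos : ∀ v < 8 * m, 1 ≤ κ v
  le_six : ∀ v < 8 * m, κ v ≤ 6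
  packing : ∀ v < 8 * m, ∀ w, w ≠ v → InBall m cyc (κ v) v w → κ w ≠ κ v
  dominated : dom → ∀ v < 8 * m, isInner m cyc v → κ v = 1 ∨ ∃ u ∈ nbr m cyc v, κ u = 1

/-- The mask `f`, starting at vertex `v`, only marks vertices whose colour is not `k`. -/
def Avoids (m : ℕ) (κ : ℕ → ℕ) (k v f : ℕ) : Prop :=
  ∀ w < 8 * m, v ≤ w → f.testBit (w - v) = true → κ w ≠ k

variable {dom : Bool} {κ : ℕ → ℕ} {k v f : ℕ}

lemma Avoids.shift (h : Avoids m κ k v f) : Avoids m κ k (v + 1) (f >>> 1) := by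
  intro w hw hvw hf
  rw [Nat.testBit_shiftRight, show 1 + (w - (v + 1)) = w - v by omega] at hf
  exact h w hw (by omega) hf

lemma Avoids.shift_lor (hκ : IsStripColoring m cyc dom κ) (hv : v < 8 * m) (hk : κ v = k)
    (h : Avoids m κ k v f) :
    Avoids m κ k (v + 1) (f >>> 1 ||| (ballTable m cyc k).getD v 0 >>> (v + 1)) := by
  intro w hw hvw hf
  rw [Nat.testBit_lor, Bool.or_eq_true] at hf
  obtain hf | hf := hf
  · exact h.shift w hw hvw hf
  · rw [Nat.testBit_shiftRight, show v + 1 + (w - (v + 1)) = w by omega,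
      testBit_ballTable k hv] at hf
    subst hk
    exact hκ.packing v hv w (by omega) hf

lemma Avoids.land_one (h : Avoids m κ k v f) (hv : v < 8 * m) (hk : κ v = k) : f &&& 1 = 0 := by
  have : f.testBit 0 ≠ true := fun hf => h v hv le_rfl (by simpa using hf) hk
  rw [Nat.and_one_is_mod]
  simpa using this

/-- The mask `f`, starting at vertex `v - 4`, marks the neighbours of the vertices before `v` of
colour `1`; from `v` on it only marks vertices whose colour is not `1`. -/
structure AvoidsOne (m : ℕ) (cyc : Bool) (κ : ℕ → ℕ) (v f : ℕ) : Prop where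
  ne_one : ∀ w < 8 * m, v ≤ w → f.testBit (w + 4 - v) = true → κ w ≠ 1
  marks : ∀ w < 8 * m, v ≤ w + 4 → ∀ u < v, κ u = 1 → (u = w ∨ u ∈ nbr m cyc w) →
    f.testBit (w + 4 - v) = true

lemma AvoidsOne.shift (h : AvoidsOne m cyc κ v f) (hk : κ v ≠ 1) :
    AvoidsOne m cyc κ (v + 1) (f >>> 1) where
  ne_one w hw hvw hf := by
    rw [Nat.testBit_shiftRight, show 1 + (w + 4 - (v + 1)) = w + 4 - v by omega] at hf
    exact h.ne_one w hw (by omega) hf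
  marks w hw hvw u hu hu1 huw := by
    rw [Nat.testBit_shiftRight, show 1 + (w + 4 - (v + 1)) = w + 4 - v by omega]
    have : u ≠ v := by rintro rfl; exact hk hu1
    exact h.marks w hw (by omega) u (by omega) hu1 huw

lemma AvoidsOne.shift_lor (hκ : IsStripColoring m cyc dom κ) (hv : v < 8 * m) (hk : κ v = 1)
    (h : AvoidsOne m cyc κ v f) :
    AvoidsOne m cyc κ (v + 1) (f >>> 1 ||| (ballTable m cyc 1).getD v 0 <<< 3 >>> v) := by
  have hb (w : ℕ) (hvw : v + 1 ≤ w + 4) :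
      ((ballTable m cyc 1).getD v 0 <<< 3 >>> v).testBit (w + 4 - (v + 1)) = true ↔
        InBall m cyc 1 v w := by
    rw [Nat.testBit_shiftRight, Nat.testBit_shiftLeft,
      show v + (w + 4 - (v + 1)) - 3 = w by omega, Bool.and_eq_true, testBit_ballTable 1 hv,
      decide_eq_true_eq]
    exact and_iff_right (by omega)
  constructor
  · intro w hw hvw hf
    rw [Nat.testBit_lor, Bool.or_eq_true, hb w (by omega)] at hf
    obtain hf | hf := hf
    · rw [Nat.testBit_shiftRight, show 1 + (w + 4 - (v + 1)) = w + 4 - v by omega] at hf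
      exact h.ne_one w hw (by omega) hf
    · rw [← hk] at hf ⊢
      exact hκ.packing v hv w (by omega) hf
  · intro w hw hvw u hu hu1 huw
    rw [Nat.testBit_lor, Bool.or_eq_true, hb w hvw]
    obtain rfl | hne := eq_or_ne u v
    · right
      obtain rfl | huw := huw
      · exact Or.inl rfl
      · exact Or.inr ⟨w, mem_nbr_symm hw huw, rfl⟩
    · left
      rw [Nat.testBit_shiftRight, show 1 + (w + 4 - (v + 1)) = w + 4 - v by omega]
      exact h.marks w hw (by omega) u (by omega) hu1 huw

lemma AvoidsOne.land_sixteen (h : AvoidsOne m cyc κ v f) (hv : v < 8 * m) (hk : κ v = 1) :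
    f &&& 16 = 0 := by
  have : f.testBit 4 = false := by
    rw [← Bool.not_eq_true]
    exact fun hf => h.ne_one v hv le_rfl (by simpa using hf) hk
  rw [show 16 = 2 ^ 4 by rfl, Nat.and_two_pow, this]
  rfl

lemma of_testBit_settled {w : ℕ} (hv : v < 8 * m) (h : (settled m cyc dom v).testBit w = true) :
    dom = true ∧ w < 8 * m ∧ isInner m cyc w = true ∧ w ≤ v ∧ ∀ u ∈ nbr m cyc w, u ≤ v := by
  unfold settled at h
  cases dom
  · simp at h
  refine ⟨rfl, ?_⟩
  have hl : ∀ w ∈ v :: nbr m cyc v, w < 8 * m := by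
    rintro w (_ | ⟨_, hw⟩)
    exacts [hv, nbr_lt hv hw]
  simp only [cond_true] at h
  generalize v :: nbr m cyc v = l at h hl
  induction l with
  | nil => simp at h
  | cons a l ih =>
    rw [List.foldr_cons] at h
    split_ifs at h with ha
    · rw [Nat.testBit_lor, Bool.or_eq_true, Nat.one_shiftLeft, Nat.testBit_two_pow,
        decide_eq_true_eq] at h
      obtain rfl | h := h
      · simp only [Bool.and_eq_true, decide_eq_true_eq, List.all_eq_true] at ha
        exact ⟨hl a (by simp), ha.1.1, ha.1.2, ha.2⟩
      · exact ih h fun w hw => hl w (by simp [hw])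
    · exact ih h fun w hw => hl w (by simp [hw])

lemma AvoidsOne.land_settled (hκ : IsStripColoring m cyc dom κ) (h : AvoidsOne m cyc κ v f)
    (hv : v < 8 * m) (hk : κ v ≠ 1) :
    f &&& settled m cyc dom v <<< 4 >>> v = settled m cyc dom v <<< 4 >>> v := by
  refine Nat.eq_of_testBit_eq fun j => ?_
  rw [Nat.testBit_land]
  by_cases hj : (settled m cyc dom v <<< 4 >>> v).testBit j = true
  swap
  · simp only [Bool.not_eq_true] at hj
    simp [hj]
  rw [hj, Bool.and_true]
  rw [Nat.testBit_shiftRight, Nat.testBit_shiftLeft, Bool.and_eq_true, decide_eq_true_eq] at hj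
  obtain ⟨hd, hw, hi, hwv, hn⟩ := of_testBit_settled hv hj.2
  have hjv : j = v + j - 4 + 4 - v := by omega
  have hlt {u : ℕ} (hu : κ u = 1) (huv : u ≤ v) : u < v :=
    lt_of_le_of_ne huv (by rintro rfl; exact hk hu)
  rw [hjv]
  obtain h1 | ⟨u, hu, h1⟩ := hκ.dominated hd _ hw hi
  · exact h.marks _ hw (by omega) _ (hlt h1 hwv) h1 (Or.inl rfl)
  · exact h.marks _ hw (by omega) u (hlt h1 (hn u hu)) h1 (Or.inr hu)

/-- The rows on which `run` searches. -/
def rowAt (m : ℕ) (cyc dom : Bool) (v : ℕ) : Row :=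
  ⟨settled m cyc dom v <<< 4 >>> v, (ballTable m cyc 1).getD v 0 <<< 3 >>> v,
    (ballTable m cyc 2).getD v 0 >>> (v + 1), (ballTable m cyc 3).getD v 0 >>> (v + 1),
    (ballTable m cyc 4).getD v 0 >>> (v + 1), (ballTable m cyc 5).getD v 0 >>> (v + 1),
    (ballTable m cyc 6).getD v 0 >>> (v + 1)⟩

lemma run_eq (f1 f2 f3 f4 f5 f6 : ℕ) : run m cyc dom f1 f2 f3 f4 f5 f6 =
    search ((List.range (8 * m)).map (rowAt m cyc dom)) f1 f2 f3 f4 f5 f6 := by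
  simp only [run, forceList_eq, forceRows_eq, callForced_eq]
  rfl

lemma search_range'_eq_true (hκ : IsStripColoring m cyc dom κ) (n : ℕ) {f1 f2 f3 f4 f5 f6 : ℕ}
    (hn : v + n = 8 * m) (h1 : AvoidsOne m cyc κ v f1) (h2 : Avoids m κ 2 v f2)
    (h3 : Avoids m κ 3 v f3) (h4 : Avoids m κ 4 v f4) (h5 : Avoids m κ 5 v f5)
    (h6 : Avoids m κ 6 v f6) :
    search ((List.range' v n).map (rowAt m cyc dom)) f1 f2 f3 f4 f5 f6 = true := by
  induction n generalizing v f1 f2 f3 f4 f5 f6 with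
  | zero => rfl
  | succ n ih =>
    have hv : v < 8 * m := by omega
    have hn' : v + 1 + n = 8 * m := by omega
    rw [List.range'_succ, List.map_cons, search_cons]
    by_cases c1 : κ v = 1
    · rw [show search _ (f1 >>> 1 ||| (rowAt m cyc dom v).b1) _ _ _ _ _ = true from
          ih hn' (h1.shift_lor hκ hv c1) h2.shift h3.shift h4.shift h5.shift h6.shift,
        tryColor_of_disjoint (h1.land_sixteen hv c1)]
    have hs := h1.land_settled hκ hv c1
    have hs' : (f1 &&& (rowAt m cyc dom v).need).beq (rowAt m cyc dom v).need = true := by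
      rw [Nat.beq_eq]; exact hs
    rw [hs', cond_true]
    have hc : κ v = 2 ∨ κ v = 3 ∨ κ v = 4 ∨ κ v = 5 ∨ κ v = 6 := by
      have := hκ.pos v hv
      have := hκ.le_six v hv
      omega
    obtain c | c | c | c | c := hc
    · rw [show search _ _ (f2 >>> 1 ||| (rowAt m cyc dom v).b2) _ _ _ _ = true from
          ih hn' (h1.shift c1) (h2.shift_lor hκ hv c) h3.shift h4.shift h5.shift h6.shift,
        tryColor_of_disjoint (h2.land_one hv c), tryColor_true]
    · rw [show search _ _ _ (f3 >>> 1 ||| (rowAt m cyc dom v).b3) _ _ _ = true from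
          ih hn' (h1.shift c1) h2.shift (h3.shift_lor hκ hv c) h4.shift h5.shift h6.shift,
        tryColor_of_disjoint (h3.land_one hv c), tryColor_true, tryColor_true]
    · rw [show search _ _ _ _ (f4 >>> 1 ||| (rowAt m cyc dom v).b4) _ _ = true from
          ih hn' (h1.shift c1) h2.shift h3.shift (h4.shift_lor hκ hv c) h5.shift h6.shift,
        tryColor_of_disjoint (h4.land_one hv c), tryColor_true, tryColor_true, tryColor_true]
    · rw [show search _ _ _ _ _ (f5 >>> 1 ||| (rowAt m cyc dom v).b5) _ = true from
          ih hn' (h1.shift c1) h2.shift h3.shift h4.shift (h5.shift_lor hκ hv c) h6.shift,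
        tryColor_of_disjoint (h5.land_one hv c)]
      simp only [tryColor_true]
    · rw [show search _ _ _ _ _ _ (f6 >>> 1 ||| (rowAt m cyc dom v).b6) = true from
          ih hn' (h1.shift c1) h2.shift h3.shift h4.shift h5.shift (h6.shift_lor hκ hv c),
        tryColor_of_disjoint (h6.land_one hv c)]
      simp only [tryColor_true]

lemma run_eq_true (hκ : IsStripColoring m cyc dom κ) {f1 f2 f3 f4 f5 f6 : ℕ}
    (h1 : ∀ v < 8 * m, f1.testBit (v + 4) = true → κ v ≠ 1)
    (h2 : ∀ v < 8 * m, f2.testBit v = true → κ v ≠ 2)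
    (h3 : ∀ v < 8 * m, f3.testBit v = true → κ v ≠ 3)
    (h4 : ∀ v < 8 * m, f4.testBit v = true → κ v ≠ 4)
    (h5 : ∀ v < 8 * m, f5.testBit v = true → κ v ≠ 5)
    (h6 : ∀ v < 8 * m, f6.testBit v = true → κ v ≠ 6) :
    run m cyc dom f1 f2 f3 f4 f5 f6 = true := by
  rw [run_eq, List.range_eq_range']
  have H {k f : ℕ} (h : ∀ v < 8 * m, f.testBit v = true → κ v ≠ k) : Avoids m κ k 0 f :=
    fun w hw _ => h w hw
  exact search_range'_eq_true hκ _ (Nat.zero_add _)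
    ⟨fun w hw _ => h1 w hw, fun w _ _ u hu => absurd hu (Nat.not_lt_zero u)⟩
    (H h2) (H h3) (H h4) (H h5) (H h6)

/-- Every vertex not of colour `1` has a neighbour of colour `1`. -/
def IsOneDominated {V : Type*} (G : SimpleGraph V) (π : V → ℕ) : Prop :=
  ∀ x, π x = 1 ∨ ∃ y, G.Adj x y ∧ π y = 1

lemma exists_isOneDominated {V : Type*} [Finite V] {G : SimpleGraph V} {n : ℕ} {π : V → ℕ}
    (h : IsPackingColoring G n π) : ∃ π', IsPackingColoring G n π' ∧ IsOneDominated G π' := by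
  classical
  have := Fintype.ofFinite V
  obtain ⟨π', hπ, hmin⟩ := (measure fun π : V → ℕ => ∑ x, π x).wf.has_min
    {π | IsPackingColoring G n π} ⟨π, h⟩
  refine ⟨π', hπ, ?_⟩
  by_contra hd
  simp only [IsOneDominated, not_forall, not_or, not_exists, not_and] at hd
  obtain ⟨x, hx1, hx⟩ := hd
  have hlen {v : V} (hv : v ≠ x) (h1 : π' v = 1) (p : G.Walk x v) : 1 < p.length := by
    by_contra hp
    interval_cases hl : p.length
    · exact hv (SimpleGraph.Walk.eq_of_length_eq_zero hl).symm
    · exact hx v (SimpleGraph.Walk.adj_of_length_eq_one hl) h1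
  refine hmin (Function.update π' x 1) ⟨fun v => ?_, fun u v huv hc p => ?_⟩ ?_
  · obtain rfl | hv := eq_or_ne v x
    · have := hπ.1 v
      rw [Function.update_self]
      omega
    · rw [Function.update_of_ne hv]
      exact hπ.1 v
  · obtain rfl | hu := eq_or_ne u x
    · rw [Function.update_self, Function.update_of_ne huv.symm] at hc
      rw [Function.update_self]
      exact hlen huv.symm hc.symm p
    rw [Function.update_of_ne hu] at hc ⊢
    obtain rfl | hv := eq_or_ne v x
    · rw [Function.update_self] at hc
      rw [hc, ← p.length_reverse]
      exact hlen hu hc p.reverse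
    · rw [Function.update_of_ne hv] at hc
      exact hπ.2 u v huv hc p
  · change ∑ v, Function.update π' x 1 v < ∑ v, π' v
    refine Finset.sum_lt_sum (fun v _ => ?_) ⟨x, Finset.mem_univ x, ?_⟩
    · obtain rfl | hv := eq_or_ne v x
      · rw [Function.update_self]
        exact (hπ.1 v).1
      · rw [Function.update_of_ne hv]
    · rw [Function.update_self]
      have := (hπ.1 x).1
      omega

lemma place_injOn (h : IsPlacement r m cyc s ε) (hm : m ≤ r) {v w : ℕ} (hv : v < 8 * m)
    (hw : w < 8 * m) (hvw : place r s ε v = place r s ε w) : v = w := by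
  simp only [place, Prod.mk.injEq, ZMod.intCast_eq_intCast_iff_dvd_sub, Fin.ext_iff,
    Fin.ofNat] at hvw
  obtain ⟨h1, h2⟩ := hvw
  have h3 : ((2 * r : ℕ) : ℤ) ∣ ((w / 4 : ℕ) : ℤ) - (v / 4 : ℕ) := by
    have h4 : (s + ε * ((w / 4 : ℕ) : ℤ) - (s + ε * ((v / 4 : ℕ) : ℤ))) =
        ε * (((w / 4 : ℕ) : ℤ) - (v / 4 : ℕ)) := by ring
    rw [h4] at h2
    obtain ⟨rfl, -⟩ | ⟨rfl, -⟩ := h.dir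
    · rwa [one_mul] at h2
    · rwa [neg_one_mul, dvd_neg] at h2
  have h4 := Int.eq_zero_of_abs_lt_dvd h3 (by rw [abs_lt]; omega)
  omega

lemma isStripColoring_comp_place {π : Fin (2 + 2) × ZMod (2 * r) → ℕ}
    (hπ : IsPackingColoring (genHgraph 2 r) 6 π) (h : IsPlacement r m cyc s ε) (hm : m ≤ r)
    (hd : dom → IsOneDominated (genHgraph 2 r) π) :
    IsStripColoring m cyc dom (π ∘ place r s ε) where
  pos v _ := (hπ.1 _).1
  le_six v _ := (hπ.1 _).2
  packing v hv w hwv hb hc := by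
    obtain ⟨p, hp⟩ := hb.exists_walk h hv
    refine (hπ.2 _ _ (fun he => hwv ?_) hc.symm p).not_ge hp
    exact place_injOn h hm (hb.lt hv) hv he.symm
  dominated hdom v hv hi := by
    refine (hd hdom (place r s ε v)).imp_right ?_
    rintro ⟨y, hy, h1⟩
    obtain ⟨u, hu, rfl⟩ := exists_mem_nbr_of_adj_place h hv hi hy
    exact ⟨u, hu, h1⟩

/-- The first `8 * m` vertices. -/
def allMask (m : ℕ) : ℕ := 2 ^ (8 * m) - 1

/-- The vertices on level `0`. -/
def outerMask (m : ℕ) : ℕ := allMask m / 15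

lemma run_three_five_colors : run 3 false false 0 0 0 0 0 (allMask 3) = false := by
  decide +kernel

lemma not_isPackingColoring_five (hr : 3 ≤ r) (π : Fin (2 + 2) × ZMod (2 * r) → ℕ) :
    ¬ IsPackingColoring (genHgraph 2 r) 5 π := by
  intro hπ
  have h6 : IsPackingColoring (genHgraph 2 r) 6 π :=
    ⟨fun v => ⟨(hπ.1 v).1, (hπ.1 v).2.trans (by norm_num)⟩, hπ.2⟩
  have hκ := isStripColoring_comp_place h6 (m := 3) (cyc := false) (dom := false) (s := 0) (ε := 1)
    ⟨by omega, Or.inl ⟨rfl, Even.zero⟩, by simp⟩ hr (by simp)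
  have := run_eq_true hκ (f1 := 0) (f2 := 0) (f3 := 0) (f4 := 0) (f5 := 0) (f6 := allMask 3)
    (by simp) (by simp) (by simp) (by simp) (by simp)
    fun v _ _ h => absurd (hπ.1 (place r 0 1 v)).2 (by simp_all)
  simp [run_three_five_colors] at this

lemma run_two : run 2 true true 0 0 0 0 0 0 = false := by decide +kernel

lemma run_four_outer : run 4 true true 0 0 (outerMask 4) 0 0 0 = false := by decide +kernel

lemma run_six_outer : run 6 false true 0 0 (outerMask 6) 0 0 0 = false := by decide +kernel

lemma exists_three_on_outer {π : Fin (2 + 2) × ZMod (2 * r) → ℕ}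
    (hπ : IsPackingColoring (genHgraph 2 r) 6 π) (hd : IsOneDominated (genHgraph 2 r) π)
    (h : IsPlacement r m cyc 0 1) (hm : m ≤ r)
    (hrun : run m cyc true 0 0 (outerMask m) 0 0 0 = false)
    (hmask : ∀ v < 8 * m, (outerMask m).testBit v = true → v % 4 = 0) :
    ∃ j : ℕ, π (0, j) = 3 := by
  have hκ := isStripColoring_comp_place hπ (dom := true) h hm fun _ => hd
  by_contra! hne
  have := run_eq_true hκ (f1 := 0) (f2 := 0) (f3 := outerMask m) (f4 := 0) (f5 := 0) (f6 := 0)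
    (by simp) (by simp) (fun v hv hb => ?_) (by simp) (by simp) (by simp)
  · simp [hrun] at this
  · have h0 : Fin.ofNat 4 v = (0 : Fin (2 + 2)) := by
      ext
      exact hmask v hv hb
    have hp : place r 0 1 v = (0, ((v / 4 : ℕ) : ZMod (2 * r))) := by
      simp only [place, h0, zero_add, one_mul, Int.cast_natCast]
    rw [Function.comp_apply, hp]
    exact hne (v / 4)

/-- No `6`-colouring of `genHgraph 2 r` has a vertex of level `0` of colour `3`. -/
lemma ne_three_of_run (hr : 2 ≤ r)
    (hrun : run r true true 16 1 0 1 1 1 = false) {π : Fin (2 + 2) × ZMod (2 * r) → ℕ}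
    (hπ : IsPackingColoring (genHgraph 2 r) 6 π) (hd : IsOneDominated (genHgraph 2 r) π)
    (j : ℕ) : π (0, j) ≠ 3 := by
  intro h3
  obtain ⟨ε, hε⟩ : ∃ ε : ℤ, ε = 1 ∧ Even (j : ℤ) ∨ ε = -1 ∧ Odd (j : ℤ) := by
    obtain h | h := Int.even_or_odd j
    · exact ⟨1, Or.inl ⟨rfl, h⟩⟩
    · exact ⟨-1, Or.inr ⟨rfl, h⟩⟩
  have hκ := isStripColoring_comp_place hπ (m := r) (cyc := true) (dom := true) (s := j) (ε := ε)
    ⟨hr, hε, fun _ => rfl⟩ le_rfl fun _ => hd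
  have h0 : (π ∘ place r j ε) 0 = 3 := by
    simpa [place] using h3
  have hbit {v n k : ℕ} (hk : k ≠ 3) (h : (2 ^ n).testBit (v + n) = true) :
      (π ∘ place r j ε) v ≠ k := by
    rw [Nat.testBit_two_pow, decide_eq_true_eq] at h
    obtain rfl : v = 0 := by omega
    rw [h0]
    exact hk.symm
  have := run_eq_true hκ (f1 := 16) (f2 := 1) (f3 := 0) (f4 := 1) (f5 := 1) (f6 := 1)
    (fun v _ h => hbit (n := 4) (by norm_num) h) (fun v _ h => hbit (n := 0) (by norm_num) h)
    (by simp) (fun v _ h => hbit (n := 0) (by norm_num) h)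
    (fun v _ h => hbit (n := 0) (by norm_num) h) (fun v _ h => hbit (n := 0) (by norm_num) h)
  simp [hrun] at this

lemma run_four_three : run 4 true true 16 1 0 1 1 1 = false := by decide +kernel

lemma run_seven_three : run 7 true true 16 1 0 1 1 1 = false := by decide +kernel

lemma run_eight_three : run 8 true true 16 1 0 1 1 1 = false := by decide +kernel

lemma run_eleven_three : run 11 true true 16 1 0 1 1 1 = false := by decide +kernel

lemma not_isPackingColoring_six (hr : r = 2 ∨ r = 4 ∨ r = 7 ∨ r = 8 ∨ r = 11)
    (π : Fin (2 + 2) × ZMod (2 * r) → ℕ) : ¬ IsPackingColoring (genHgraph 2 r) 6 π := by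
  intro hπ'
  have : NeZero (2 * r) := ⟨by omega⟩
  obtain ⟨π, hπ, hd⟩ := exists_isOneDominated hπ'
  have hP (h : 2 ≤ r) : IsPlacement r r true 0 1 := ⟨h, Or.inl ⟨rfl, Even.zero⟩, fun _ => rfl⟩
  have hP' (h : 2 ≤ r) : IsPlacement r 6 false 0 1 := ⟨h, Or.inl ⟨rfl, Even.zero⟩, by simp⟩
  have hmask : ∀ v < 48, (outerMask 6).testBit v = true → v % 4 = 0 := by decide +kernel
  have hmask' : ∀ v < 32, (outerMask 4).testBit v = true → v % 4 = 0 := by decide +kernel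
  obtain rfl | rfl | rfl | rfl | rfl := hr
  · have hκ := isStripColoring_comp_place hπ (dom := true) (hP le_rfl) le_rfl fun _ => hd
    have := run_eq_true hκ (f1 := 0) (f2 := 0) (f3 := 0) (f4 := 0) (f5 := 0) (f6 := 0)
      (by simp) (by simp) (by simp) (by simp) (by simp) (by simp)
    simp [run_two] at this
  · obtain ⟨j, hj⟩ := exists_three_on_outer hπ hd (hP (by norm_num)) le_rfl run_four_outer hmask'
    exact ne_three_of_run (by norm_num) run_four_three hπ hd j hj
  · obtain ⟨j, hj⟩ :=
      exists_three_on_outer hπ hd (hP' (by norm_num)) (by norm_num) run_six_outer hmask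
    exact ne_three_of_run (by norm_num) run_seven_three hπ hd j hj
  · obtain ⟨j, hj⟩ :=
      exists_three_on_outer hπ hd (hP' (by norm_num)) (by norm_num) run_six_outer hmask
    exact ne_three_of_run (by norm_num) run_eight_three hπ hd j hj
  · obtain ⟨j, hj⟩ :=
      exists_three_on_outer hπ hd (hP' (by norm_num)) (by norm_num) run_six_outer hmask
    exact ne_three_of_run (by norm_num) run_eleven_three hπ hd j hj

/-- The colour of vertex `v` in the strip coloured by the word `K`, whose letters encode the colours
of the columns by decimal digits. -/
def wordColor (K : List ℕ) (v : ℕ) : ℕ := K.getD (v / 4) 0 / 10 ^ (v % 4) % 10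

/-- The vertices of colour `c`. -/
def colorMask (m : ℕ) (K : List ℕ) (c : ℕ) : ℕ :=
  (List.range (8 * m)).foldr (fun v x => if wordColor K v = c then 1 <<< v ||| x else x) 0

lemma testBit_colorMask {K : List ℕ} {c w : ℕ} (hw : w < 8 * m) (hc : wordColor K w = c) :
    (colorMask m K c).testBit w = true := by
  have hmem : w ∈ List.range (8 * m) := List.mem_range.2 hw
  unfold colorMask
  generalize List.range (8 * m) = l at hmem
  induction l with
  | nil => simp at hmem
  | cons a l ih =>
    rw [List.foldr_cons]
    obtain rfl | hmem := List.mem_cons.1 hmem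
    · simp [hc, Nat.one_shiftLeft]
    · split_ifs
      · rw [Nat.testBit_lor, ih hmem, Bool.or_true]
      · exact ih hmem

/-- Whether vertices of the same colour, one of the `n` colours from `c + 1` on, are far enough
apart, given the table of balls of radius `c`. -/
def checkColors (m : ℕ) (cyc : Bool) (K : List ℕ) : ℕ → ℕ → List ℕ → Bool
  | 0, _, _ => true
  | n + 1, c, T => forceList (grow m cyc T) fun T' => force (colorMask m K (c + 1)) fun M =>
      (List.range (8 * m)).all (fun v =>
        wordColor K v != c + 1 || (T'.getD v 0).land M == 1 <<< v) &&
      checkColors m cyc K n (c + 1) T'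

/-- Whether `K` gives a packing colouring of the strip by the colours `1, …, n`. -/
def checkWord (m : ℕ) (cyc : Bool) (n : ℕ) (K : List ℕ) : Bool :=
  (List.range (8 * m)).all (fun v => 1 ≤ wordColor K v && wordColor K v ≤ n) &&
    forceList (ballTable m cyc 0) (checkColors m cyc K n 0)

lemma ball_inter_colorMask_of_checkColors {n c : ℕ} {K : List ℕ}
    (h : checkColors m cyc K n c (ballTable m cyc c)) {v : ℕ} (hv : v < 8 * m)
    (hc : c < wordColor K v) (hn : wordColor K v ≤ c + n) :
    (ballTable m cyc (wordColor K v)).getD v 0 &&& colorMask m K (wordColor K v) = 1 <<< v := by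
  induction n generalizing c with
  | zero => omega
  | succ n ih =>
    simp only [checkColors, forceList_eq, force_eq, Bool.and_eq_true, List.all_eq_true,
      List.mem_range] at h
    obtain hc' | hc' := eq_or_ne (wordColor K v) (c + 1)
    · have := h.1 v hv
      simp only [hc', bne_self_eq_false, Bool.false_or, beq_iff_eq] at this
      rw [hc']
      exact this
    · exact ih h.2 (by omega) (by omega)

lemma wordColor_mem_of_checkWord {n : ℕ} {K : List ℕ} (h : checkWord m cyc n K) {v : ℕ}
    (hv : v < 8 * m) : 1 ≤ wordColor K v ∧ wordColor K v ≤ n := by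
  simp only [checkWord, Bool.and_eq_true, List.all_eq_true, List.mem_range,
    decide_eq_true_eq] at h
  exact h.1 v hv

lemma eq_of_checkWord {n : ℕ} {K : List ℕ} (h : checkWord m cyc n K) {v w : ℕ} (hv : v < 8 * m)
    (hc : wordColor K w = wordColor K v) (hb : InBall m cyc (wordColor K v) v w) : w = v := by
  obtain ⟨h1, h2⟩ := wordColor_mem_of_checkWord h hv
  rw [checkWord, Bool.and_eq_true, forceList_eq] at h
  have h3 := congrArg (Nat.testBit · w)
    (ball_inter_colorMask_of_checkColors h.2 hv h1 ((Nat.zero_add n).symm ▸ h2))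
  simp only [Nat.testBit_land, (testBit_ballTable _ hv w).2 hb, testBit_colorMask (hb.lt hv) hc,
    Nat.one_shiftLeft, Nat.testBit_two_pow, Bool.and_true] at h3
  exact (of_decide_eq_true h3.symm).symm

/-- The colouring given by columns whose colours are the decimal digits of the values of `G`. -/
def columnColoring (r : ℕ) (G : ℕ → ℕ) (x : Fin (2 + 2) × ZMod (2 * r)) : ℕ :=
  G x.2.val / 10 ^ (x.1 : ℕ) % 10

lemma columnColoring_place {G : ℕ → ℕ} {K : List ℕ} {s v : ℕ}
    (h : G ((s + v / 4) % (2 * r)) = K.getD (v / 4) 0) :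
    columnColoring r G (place r s 1 v) = wordColor K v := by
  have h1 : (((s : ℤ) + 1 * ((v / 4 : ℕ) : ℤ) : ℤ) : ZMod (2 * r)) =
      ((s + v / 4 : ℕ) : ZMod (2 * r)) := by
    rw [one_mul]; exact_mod_cast rfl
  rw [columnColoring, place, h1, ZMod.val_natCast, h]
  rfl

lemma isPackingColoring_columnColoring (hr : 2 ≤ r) {n : ℕ} {G : ℕ → ℕ}
    (hG : ∀ t < 2 * r, ∃ (m : ℕ) (cyc : Bool) (K : List ℕ) (s τ : ℕ), (cyc → m = r) ∧ Even s ∧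
      τ < 2 * m ∧ (s + τ) % (2 * r) = t ∧ (cyc = false → n ≤ τ ∧ τ + n < 2 * m) ∧
      checkWord m cyc n K ∧ ∀ j < 2 * m, G ((s + j) % (2 * r)) = K.getD j 0) :
    IsPackingColoring (genHgraph 2 r) n (columnColoring r G) := by
  have : NeZero (2 * r) := ⟨by omega⟩
  have key (x : Fin (2 + 2) × ZMod (2 * r)) : ∃ (m : ℕ) (cyc : Bool) (K : List ℕ) (s v : ℕ),
      IsPlacement r m cyc s 1 ∧ v < 8 * m ∧ place r s 1 v = x ∧
      (cyc = false → 4 * n ≤ v ∧ v + 4 * n < 8 * m) ∧ checkWord m cyc n K ∧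
      ∀ w < 8 * m, columnColoring r G (place r s 1 w) = wordColor K w := by
    obtain ⟨m, cyc, K, s, τ, hm, hs, hτ, ht, hn, hK, hG⟩ := hG x.2.val (ZMod.val_lt x.2)
    have hx := x.1.isLt
    refine ⟨m, cyc, K, s, 4 * τ + x.1, ⟨hr, Or.inl ⟨rfl, by simpa using hs⟩, hm⟩, by omega, ?_,
      fun hc => ?_, hK, fun w hw => columnColoring_place (hG _ (by omega))⟩
    · have h4 : (4 * τ + (x.1 : ℕ)) / 4 = τ := by omega
      have h1 : (((s : ℤ) + 1 * (τ : ℤ) : ℤ) : ZMod (2 * r)) =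
          ((s + τ : ℕ) : ZMod (2 * r)) := by
        rw [one_mul]; exact_mod_cast rfl
      rw [place, h4, h1, ← ZMod.natCast_mod, ht, ZMod.natCast_zmod_val]
      refine Prod.ext (Fin.ext ?_) rfl
      change (4 * τ + (x.1 : ℕ)) % 4 = x.1
      omega
    · have := hn hc
      omega
  refine ⟨fun x => ?_, fun x y hxy hc p => ?_⟩
  · obtain ⟨m, cyc, K, s, v, -, hv, rfl, -, hK, hG⟩ := key x
    rw [hG v hv]
    exact wordColor_mem_of_checkWord hK hv
  · by_contra! hp
    obtain ⟨m, cyc, K, s, v, hP, hv, hx, hn, hK, hG⟩ := key x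
    have hvc : columnColoring r G x = wordColor K v := by rw [← hx, hG v hv]
    have hcn := (wordColor_mem_of_checkWord hK hv).2
    rw [hvc] at hc hp
    obtain ⟨w, rfl, hb⟩ :=
      exists_inBall_of_walk hP hv (fun h => by have := hn h; omega) p hx hp
    rw [hG w (hb.lt hv)] at hc
    obtain rfl := eq_of_checkWord hK hv hc.symm hb
    exact hxy hx.symm

lemma exists_isPackingColoring_of_checkWord (hr : 2 ≤ r) {n : ℕ} {K : List ℕ}
    (hK : checkWord r true n K) : ∃ π, IsPackingColoring (genHgraph 2 r) n π :=
  ⟨_, isPackingColoring_columnColoring (G := fun j => K.getD j 0) hr fun t ht =>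
    ⟨r, true, K, 0, t, fun _ => rfl, Even.zero, ht, by rw [zero_add, Nat.mod_eq_of_lt ht],
      by simp, hK, fun j hj => by rw [zero_add, Nat.mod_eq_of_lt hj]⟩⟩

/-- The columns from `s` on, modulo `2 * r`, are those of the word `K`. -/
def Spells (r : ℕ) (G : ℕ → ℕ) (s : ℕ) (K : List ℕ) : Prop :=
  ∀ j < K.length, G ((s + j) % (2 * r)) = K.getD j 0

variable {G : ℕ → ℕ} {p q : ℕ} {X Y Z : List ℕ}

lemma spells_append : Spells r G p (X ++ Y) ↔ Spells r G p X ∧ Spells r G (p + X.length) Y := by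
  constructor
  · refine fun h => ⟨fun j hj => ?_, fun j hj => ?_⟩
    · rw [h j (by rw [List.length_append]; omega), List.getD_append _ _ _ _ hj]
    · rw [add_assoc, h _ (by rw [List.length_append]; omega),
        List.getD_append_right _ _ _ _ (by omega), Nat.add_sub_cancel_left]
  · rintro ⟨h1, h2⟩ j hj
    rw [List.length_append] at hj
    obtain hj' | hj' := lt_or_ge j X.length
    · rw [h1 j hj', List.getD_append _ _ _ _ hj']
    · rw [List.getD_append_right _ _ _ _ hj', ← h2 _ (by omega)]
      congr 2
      omega

lemma Spells.add_period (h : Spells r G p X) : Spells r G (p + 2 * r) X := fun j hj => by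
  rw [add_right_comm, Nat.add_mod_right, h j hj]

/-- A word of length `6` that can be repeated. -/
def blockSix : List ℕ := [3121, 1613, 5141, 1312, 2131, 1415]

/-- A word of length `20` that can be repeated, preceded and followed by `blockSix`. -/
def blockTwenty : List ℕ :=
  [3161, 1213, 5121, 1314, 2131, 1612, 4151, 1213, 3121, 1514,
   2161, 1312, 4131, 1215, 3121, 1613, 5141, 1312, 2131, 1415]

/-- The columns of the colouring by `a` copies of `blockSix` and copies of `blockTwenty`. -/
def blockColumns (a : ℕ) (t : ℕ) : ℕ :=
  if t < 6 * a then blockSix.getD (t % 6) 0 else blockTwenty.getD ((t - 6 * a) % 20) 0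

lemma checkWord_blocks {Y Z : List ℕ} (hY : Y ∈ [blockSix, blockTwenty])
    (hZ : Z ∈ [blockSix, blockTwenty]) :
    checkWord (Y.length / 2 + 6) false 6 (blockSix ++ (Y ++ Z.take 6)) = true := by
  have h : [blockSix, blockTwenty].all (fun Y => [blockSix, blockTwenty].all fun Z =>
      checkWord (Y.length / 2 + 6) false 6 (blockSix ++ (Y ++ Z.take 6))) = true := by
    decide +kernel
  rw [List.all_eq_true] at h
  have h1 := h Y hY
  rw [List.all_eq_true] at h1
  exact h1 Z hZ

section

variable {a b : ℕ}

lemma spells_blockSix (hr : 6 * a + 20 * b = 2 * r) (hq : q < a) :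
    Spells r (blockColumns a) (6 * q) blockSix := by
  intro j hj
  change j < 6 at hj
  rw [Nat.mod_eq_of_lt (by omega), blockColumns, if_pos (by omega)]
  congr 1
  omega

lemma spells_blockTwenty (hr : 6 * a + 20 * b = 2 * r) (hq : q < b) :
    Spells r (blockColumns a) (6 * a + 20 * q) blockTwenty := by
  intro j hj
  change j < 20 at hj
  rw [Nat.mod_eq_of_lt (by omega), blockColumns, if_neg (by omega)]
  congr 1
  omega

lemma spells_end_blockTwenty (hr : 6 * a + 20 * b = 2 * r) (hq : q < b) :
    Spells r (blockColumns a) (6 * a + 20 * q + 14) blockSix :=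
  (spells_append (X := blockTwenty.take 14) (Y := blockSix)).1 (spells_blockTwenty hr hq) |>.2

lemma spells_end (hr : 6 * a + 20 * b = 2 * r) (hr2 : 2 ≤ r) :
    Spells r (blockColumns a) (2 * r - 6) blockSix := by
  obtain rfl | hb := Nat.eq_zero_or_pos b
  · rw [show 2 * r - 6 = 6 * (a - 1) by omega]
    exact spells_blockSix hr (by omega)
  · rw [show 2 * r - 6 = 6 * a + 20 * (b - 1) + 14 by omega]
    exact spells_end_blockTwenty hr (by omega)

lemma spells_take_six (h : Spells r G p X) : Spells r G p (X.take 6) := by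
  rw [← X.take_append_drop 6] at h
  exact (spells_append.1 h).1

/-- The beginning of a word follows. -/
def Continues (r : ℕ) (G : ℕ → ℕ) (p : ℕ) : Prop :=
  ∃ Z ∈ [blockSix, blockTwenty], Spells r G p Z

lemma continues_zero (hr : 6 * a + 20 * b = 2 * r) (hr2 : 2 ≤ r) :
    Continues r (blockColumns a) 0 := by
  obtain rfl | ha := Nat.eq_zero_or_pos a
  · exact ⟨blockTwenty, by simp, spells_blockTwenty hr (q := 0) (by omega)⟩
  · exact ⟨blockSix, by simp, spells_blockSix hr ha⟩

lemma continues_blockTwenty (hr : 6 * a + 20 * b = 2 * r) (hr2 : 2 ≤ r) (hq : q ≤ b) :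
    Continues r (blockColumns a) (6 * a + 20 * q) := by
  obtain rfl | hq := hq.eq_or_lt
  · obtain ⟨Z, hZ, h⟩ := continues_zero hr hr2
    exact ⟨Z, hZ, by simpa [hr] using h.add_period⟩
  · exact ⟨blockTwenty, by simp, spells_blockTwenty hr hq⟩

lemma continues_blockSix (hr : 6 * a + 20 * b = 2 * r) (hr2 : 2 ≤ r) (hq : q ≤ a) :
    Continues r (blockColumns a) (6 * q) := by
  obtain rfl | hq := hq.eq_or_lt
  · exact continues_blockTwenty hr hr2 (Nat.zero_le b)
  · exact ⟨blockSix, by simp, spells_blockSix hr hq⟩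

lemma exists_block (hr : 6 * a + 20 * b = 2 * r) (hr2 : 2 ≤ r) {t : ℕ} (ht : t < 2 * r) :
    ∃ Y ∈ [blockSix, blockTwenty], ∃ p ≤ t, t < p + Y.length ∧ Even p ∧
      Spells r (blockColumns a) (p + 2 * r - 6) blockSix ∧ Spells r (blockColumns a) p Y ∧
      Continues r (blockColumns a) (p + Y.length) := by
  have hend := spells_end hr hr2
  obtain hta | hta := lt_or_ge t (6 * a)
  · refine ⟨blockSix, by simp, 6 * (t / 6), by omega, ?_, ⟨3 * (t / 6), by omega⟩, ?_,
      spells_blockSix hr (by omega), continues_blockSix (q := t / 6 + 1) hr hr2 (by omega)⟩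
    · change t < 6 * (t / 6) + 6
      omega
    · obtain hq | hq := Nat.eq_zero_or_pos (t / 6)
      · simpa [hq] using hend
      · rw [show 6 * (t / 6) + 2 * r - 6 = 6 * (t / 6 - 1) + 2 * r by omega]
        exact (spells_blockSix hr (by omega)).add_period
  · set q := (t - 6 * a) / 20
    refine ⟨blockTwenty, by simp, 6 * a + 20 * q, by omega, ?_, ⟨3 * a + 10 * q, by omega⟩, ?_,
      spells_blockTwenty hr (by omega), continues_blockTwenty (q := q + 1) hr hr2 (by omega)⟩
    · change t < 6 * a + 20 * q + 20
      omega
    · obtain hq | hq := Nat.eq_zero_or_pos q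
      · obtain rfl | ha := Nat.eq_zero_or_pos a
        · simpa [hq] using hend
        · rw [show 6 * a + 20 * q + 2 * r - 6 = 6 * (a - 1) + 2 * r by omega]
          exact (spells_blockSix hr (by omega)).add_period
      · rw [show 6 * a + 20 * q + 2 * r - 6 = 6 * a + 20 * (q - 1) + 14 + 2 * r by omega]
        exact (spells_end_blockTwenty hr (by omega)).add_period

lemma isPackingColoring_blockColumns (hr : 6 * a + 20 * b = 2 * r) (hr2 : 2 ≤ r) :
    IsPackingColoring (genHgraph 2 r) 6 (columnColoring r (blockColumns a)) := by
  refine isPackingColoring_columnColoring hr2 fun t ht => ?_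
  obtain ⟨Y, hY, p, hpt, htp, hp, h1, h2, Z, hZ, h3⟩ := exists_block hr hr2 ht
  have h6 : blockSix.length = 6 := rfl
  have hZ6 : (Z.take 6).length = 6 := by fin_cases hZ <;> rfl
  have hYe : Y.length % 2 = 0 := by fin_cases hY <;> rfl
  have hr6 : 6 ≤ 2 * r := by omega
  refine ⟨Y.length / 2 + 6, false, blockSix ++ (Y ++ Z.take 6), p + 2 * r - 6, 6 + (t - p),
    by simp, ?_, by omega, ?_, by omega, checkWord_blocks hY hZ, ?_⟩
  · obtain ⟨c, rfl⟩ := hp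
    exact ⟨c + r - 3, by omega⟩
  · rw [show p + 2 * r - 6 + (6 + (t - p)) = t + 2 * r by omega, Nat.add_mod_right,
      Nat.mod_eq_of_lt ht]
  · have hK : Spells r (blockColumns a) (p + 2 * r - 6) (blockSix ++ (Y ++ Z.take 6)) := by
      rw [spells_append, spells_append, h6,
        show p + 2 * r - 6 + 6 = p + 2 * r by omega, add_right_comm]
      exact ⟨h1, h2.add_period, spells_take_six h3.add_period⟩
    intro j hj
    refine hK j ?_
    rw [List.length_append, List.length_append, h6, hZ6]
    omega

end

lemma exists_isPackingColoring_six (hr : 2 ≤ r)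
    (h : ¬(r = 2 ∨ r = 4 ∨ r = 7 ∨ r = 8 ∨ r = 11)) :
    ∃ π, IsPackingColoring (genHgraph 2 r) 6 π := by
  by_cases h5 : r = 5
  · subst h5
    exact exists_isPackingColoring_of_checkWord hr
      (K := [3121, 1413, 2151, 1312, 6141, 1213, 3151, 1412, 2131, 1516]) (by decide +kernel)
  by_cases h14 : r = 14
  · subst h14
    exact exists_isPackingColoring_of_checkWord hr
      (K := [3121, 1413, 2151, 1312, 6131, 1214, 3121, 1513, 4121, 1316, 2131, 1512, 3141, 1213,
        6151, 1312, 2141, 1513, 3121, 1416, 2131, 1512, 3141, 6213, 1251, 4312, 2131, 1516])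
      (by decide +kernel)
  by_cases h17 : r = 17
  · subst h17
    exact exists_isPackingColoring_of_checkWord hr
      (K := [3121, 1413, 2151, 1312, 6131, 1214, 3121, 1513, 4121, 1316, 2131, 1512, 3141, 6213,
        1251, 4312, 2131, 1514, 3121, 1613, 4151, 1312, 2134, 1521, 3126, 1413, 2151, 1312, 6141,
        1213, 3151, 1412, 2131, 1516])
      (by decide +kernel)
  obtain ⟨a, b, hab⟩ : ∃ a b, 6 * a + 20 * b = 2 * r := by
    have : r % 3 = 0 ∨ (r % 3 = 1 ∧ 10 ≤ r) ∨ (r % 3 = 2 ∧ 20 ≤ r) := by omega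
    obtain h0 | ⟨h1, h10⟩ | ⟨h2, h20⟩ := this
    · exact ⟨r / 3, 0, by omega⟩
    · exact ⟨(r - 10) / 3, 1, by omega⟩
    · exact ⟨(r - 20) / 3, 2, by omega⟩
  exact ⟨_, isPackingColoring_blockColumns hab hr⟩

lemma exists_isPackingColoring_seven (h : r = 2 ∨ r = 4 ∨ r = 7 ∨ r = 8 ∨ r = 11) :
    ∃ π, IsPackingColoring (genHgraph 2 r) 7 π := by
  obtain rfl | rfl | rfl | rfl | rfl := h
  · exact exists_isPackingColoring_of_checkWord (by norm_num)
      (K := [3121, 1413, 5121, 1716]) (by decide +kernel)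
  · exact exists_isPackingColoring_of_checkWord (by norm_num)
      (K := [3121, 1413, 5121, 1316, 2131, 1412, 7131, 1215]) (by decide +kernel)
  · exact exists_isPackingColoring_of_checkWord (by norm_num)
      (K := [3121, 1413, 5121, 1316, 7121, 1314, 2151, 1312, 4131, 1217, 5121, 1314, 6131, 1215])
      (by decide +kernel)
  · exact exists_isPackingColoring_of_checkWord (by norm_num)
      (K := [3121, 1413, 5121, 1316, 7121, 1413, 3251, 6142, 2131, 1417, 3121, 1513, 2141, 1312,
        6131, 1215])
      (by decide +kernel)
  · exact exists_isPackingColoring_of_checkWord (by norm_num)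
      (K := [3121, 1413, 5121, 1316, 7121, 1413, 2151, 1312, 6131, 1214, 3121, 1513, 4121, 1316,
        7121, 1314, 2131, 1512, 4131, 1217, 6131, 1215])
      (by decide +kernel)

lemma packingChromaticNumber_eq_succ {V : Type*} {G : SimpleGraph V} {n : ℕ}
    (hex : ∃ π, IsPackingColoring G (n + 1) π) (hne : ∀ π, ¬ IsPackingColoring G n π) :
    packingChromaticNumber G = n + 1 := by
  refine le_antisymm (Nat.sInf_le hex) (le_csInf ⟨_, hex⟩ ?_)
  rintro k ⟨π, hπ⟩
  by_contra! hk
  exact hne π ⟨fun v => ⟨(hπ.1 v).1, (hπ.1 v).2.trans (by omega)⟩, hπ.2⟩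

end GenHgraph

theorem packingChromaticNumber_genHgraph_two (r : ℕ) (hr : 2 ≤ r) :
    packingChromaticNumber (genHgraph 2 r) =
      if r = 2 ∨ r = 4 ∨ r = 7 ∨ r = 8 ∨ r = 11 then 7 else 6 := by
  split_ifs with h
  · exact GenHgraph.packingChromaticNumber_eq_succ (GenHgraph.exists_isPackingColoring_seven h)
      (GenHgraph.not_isPackingColoring_six h)
  · exact GenHgraph.packingChromaticNumber_eq_succ (GenHgraph.exists_isPackingColoring_six hr h)
      (GenHgraph.not_isPackingColoring_five (by omega))
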